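/- First variation of the stream function at a point away from the support: in the setting of the previous variation (ω ∈ L^∞(D) with essential support compactly contained in D, φ ∈ C_c^∞(D), Φ_t the flow of J∇φ, ω_t := ω∘Φ_{−t}), let x0 ∈ D be a point with dist(x0, supp(ω)) > 0. Then the function t ↦ ∫_D G(x0,y)·ω_t(y) dy is differentiable at t = 0 and d/dt [∫_D G(x0,y)ω_t(y)dy]|_{t=0} = ∫_D ω(y)·∂_y(G(x0,y), φ(y)) dy, where ∂_y(f,g) := ∂_{y_1}f·∂_{y_2}g − ∂_{y_2}f·∂_{y_1}g denotes the Jacobian bracket in the y-variable. -/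

import Mathlib

open MeasureTheory Metric Real Filter Topology

noncomputable section

abbrev E2 := EuclideanSpace ℝ (Fin 2)

/-- The partial derivative of `f` in the `i`-th coordinate direction. -/
def pd (f : E2 → ℝ) (i : Fin 2) (x : E2) : ℝ :=
  fderiv ℝ f x (EuclideanSpace.single i 1)

/-- The Jacobian bracket `∂(f,g) = ∂₁f ∂₂g − ∂₂f ∂₁g`. -/
def jac (f g : E2 → ℝ) (x : E2) : ℝ :=
  pd f 0 x * pd g 1 x - pd f 1 x * pd g 0 x

/-- The Hamiltonian vector field `J∇φ = (∂₂φ, −∂₁φ)`. -/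
def hamVF (φ : E2 → ℝ) (x : E2) : E2 :=
  (EuclideanSpace.equiv (Fin 2) ℝ).symm ![pd φ 1 x, -(pd φ 0 x)]

/-- `Φ` is the global flow of the vector field `V`. -/
structure IsGlobalFlow {E : Type*} [NormedAddCommGroup E] [NormedSpace ℝ E]
    (V : E → E) (Φ : ℝ → E → E) : Prop where
  map_zero : ∀ x, Φ 0 x = x
  hasDerivAt : ∀ x t, HasDerivAt (fun s => Φ s x) (V (Φ t x)) t

/-- One step of size `s` of the explicit Euler scheme for the vector field `V`. -/
def eulerStep {E : Type*} [NormedAddCommGroup E] [NormedSpace ℝ E] (V : E → E) (s : ℝ) (x : E) : E :=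
  x + s • V x

section Flow

variable {E : Type*} [NormedAddCommGroup E] [NormedSpace ℝ E]
  {V : E → E} {Φ : ℝ → E → E} {L : NNReal} {B : ℝ}

namespace IsGlobalFlow

theorem map_add (hΦ : IsGlobalFlow V Φ) (hL : LipschitzWith L V) (s t : ℝ) (x : E) :
    Φ (s + t) x = Φ s (Φ t x) := by
  have key : (fun u => Φ (u + t) x) = fun u => Φ u (Φ t x) := by
    refine ODE_solution_unique_univ (v := fun _ => V) (s := fun _ => Set.univ) (K := L) (t₀ := 0)
      (fun _ => hL.lipschitzOnWith) (fun u => ⟨?_, trivial⟩)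
      (fun u => ⟨hΦ.hasDerivAt _ u, trivial⟩) ?_
    · exact (hΦ.hasDerivAt x (u + t)).comp_add_const u t
    · simp [hΦ.map_zero]
  exact congrFun key s

theorem neg_apply_apply (hΦ : IsGlobalFlow V Φ) (hL : LipschitzWith L V) (t : ℝ) (x : E) :
    Φ (-t) (Φ t x) = x := by
  rw [← hΦ.map_add hL, neg_add_cancel, hΦ.map_zero]

theorem apply_neg_apply (hΦ : IsGlobalFlow V Φ) (hL : LipschitzWith L V) (t : ℝ) (x : E) :
    Φ t (Φ (-t) x) = x := by
  rw [← hΦ.map_add hL, add_neg_cancel, hΦ.map_zero]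

theorem norm_sub_le (hΦ : IsGlobalFlow V Φ) (hB : ∀ x, ‖V x‖ ≤ B) (s : ℝ) (x : E) :
    ‖Φ s x - x‖ ≤ B * |s| := by
  have := convex_univ.norm_image_sub_le_of_norm_hasDerivWithin_le (x := 0) (y := s)
    (fun u _ => (hΦ.hasDerivAt x u).hasDerivWithinAt) (fun u _ => hB (Φ u x)) trivial trivial
  simpa [hΦ.map_zero] using this

theorem mem_cthickening (hΦ : IsGlobalFlow V Φ) (hB : ∀ x, ‖V x‖ ≤ B) {δ : ℝ}
    {S : Set E} {z : E} (hz : z ∈ S) {t : ℝ} (ht : t ∈ ball (0 : ℝ) (δ / (B + 1))) :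
    Φ t z ∈ cthickening δ S := by
  have hB0 : 0 ≤ B := (norm_nonneg _).trans (hB z)
  refine mem_cthickening_of_dist_le _ z _ _ hz ?_
  rw [dist_eq_norm]
  rw [mem_ball_zero_iff, Real.norm_eq_abs, lt_div_iff₀ (by positivity)] at ht
  nlinarith [hΦ.norm_sub_le hB t z, abs_nonneg t]

theorem norm_sub_eulerStep_le (hΦ : IsGlobalFlow V Φ) (hL : LipschitzWith L V)
    (hB : ∀ x, ‖V x‖ ≤ B) (s : ℝ) (x : E) :
    ‖Φ s x - eulerStep V s x‖ ≤ L * B * s ^ 2 := by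
  have hB0 : 0 ≤ B := (norm_nonneg _).trans (hB x)
  have := (convex_Icc (-|s|) |s|).norm_image_sub_le_of_norm_hasDerivWithin_le
    (f := fun u => Φ u x - u • V x) (f' := fun u => V (Φ u x) - V x) (x := 0) (y := s)
    (C := L * (B * |s|))
    (fun u _ => by
      have := (hΦ.hasDerivAt x u).sub ((hasDerivAt_id u).smul_const (V x))
      rw [one_smul] at this
      exact this.hasDerivWithinAt)
    (fun u hu => by
      have h1 := hL.norm_sub_le (Φ u x) x
      have h2 := hΦ.norm_sub_le hB u x
      have h3 : |u| ≤ |s| := abs_le.2 hu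
      calc _ ≤ (L : ℝ) * ‖Φ u x - x‖ := h1
        _ ≤ L * (B * |s|) := by gcongr; exact h2.trans (by gcongr))
    (by simp) ⟨neg_abs_le s, le_abs_self s⟩
  have e : Φ s x - s • V x - (Φ 0 x - (0 : ℝ) • V x) = Φ s x - eulerStep V s x := by
    rw [hΦ.map_zero, eulerStep]; module
  simp only [e] at this
  refine this.trans_eq ?_
  rw [sub_zero, Real.norm_eq_abs, ← sq_abs s]; ring

end IsGlobalFlow

theorem continuous_eulerStep (hL : LipschitzWith L V) (s : ℝ) : Continuous (eulerStep V s) := by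
  have := hL.continuous
  unfold eulerStep
  fun_prop

theorem norm_eulerStep_sub_le (hL : LipschitzWith L V) (s : ℝ) (x y : E) :
    ‖eulerStep V s x - eulerStep V s y‖ ≤ (1 + |s| * L) * ‖x - y‖ := by
  have e : eulerStep V s x - eulerStep V s y = (x - y) + s • (V x - V y) := by
    simp only [eulerStep]; module
  rw [e]
  calc _ ≤ ‖x - y‖ + |s| * ‖V x - V y‖ := by
        simpa [norm_smul] using norm_add_le (x - y) (s • (V x - V y))
    _ ≤ ‖x - y‖ + |s| * (L * ‖x - y‖) := by gcongr; exact hL.norm_sub_le x y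
    _ = _ := by ring

theorem eulerStep_injective (hL : LipschitzWith L V) {s : ℝ} (hs : |s| * L < 1) :
    Function.Injective (eulerStep V s) := by
  intro x y hxy
  have e : x - y = -(s • (V x - V y)) := by
    have : eulerStep V s x - eulerStep V s y = 0 := sub_eq_zero.2 hxy
    simp only [eulerStep] at this
    rw [← sub_eq_zero, ← this]; module
  have h1 : ‖x - y‖ ≤ |s| * (L * ‖x - y‖) := by
    calc ‖x - y‖ = |s| * ‖V x - V y‖ := by
          conv_lhs => rw [e, norm_neg, norm_smul, Real.norm_eq_abs]
      _ ≤ _ := by gcongr; exact hL.norm_sub_le x y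
  have h2 := norm_nonneg (x - y)
  have : ‖x - y‖ = 0 := by nlinarith
  exact sub_eq_zero.1 (norm_eq_zero.1 this)

theorem IsGlobalFlow.norm_iterate_eulerStep_sub_le (hΦ : IsGlobalFlow V Φ) (hL : LipschitzWith L V)
    (hB : ∀ x, ‖V x‖ ≤ B) (s : ℝ) (x : E) (k : ℕ) :
    ‖(eulerStep V s)^[k] x - Φ (k * s) x‖ ≤ L * B * s ^ 2 * k * (1 + |s| * L) ^ k := by
  have hB0 : 0 ≤ B := (norm_nonneg _).trans (hB x)
  induction k with
  | zero => simp [hΦ.map_zero]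
  | succ k ih =>
    have e : Φ ((k + 1 : ℕ) * s) x = Φ s (Φ (k * s) x) := by
      rw [← hΦ.map_add hL]; congr 1; push_cast; ring
    rw [Function.iterate_succ_apply', e]
    have h1 := norm_eulerStep_sub_le hL s ((eulerStep V s)^[k] x) (Φ (k * s) x)
    have h2 := hΦ.norm_sub_eulerStep_le hL hB s (Φ (k * s) x)
    rw [norm_sub_rev] at h2
    have h3 := norm_sub_le_norm_sub_add_norm_sub (eulerStep V s ((eulerStep V s)^[k] x))
      (eulerStep V s (Φ (k * s) x)) (Φ s (Φ (k * s) x))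
    have hone : (1 : ℝ) ≤ (1 + |s| * L) ^ (k + 1) :=
      one_le_pow₀ (by have : 0 ≤ |s| * L := by positivity
                      linarith)
    calc _ ≤ (1 + |s| * L) * (L * B * s ^ 2 * k * (1 + |s| * L) ^ k) + L * B * s ^ 2 * 1 := by
          rw [mul_one]
          refine h3.trans (add_le_add (h1.trans ?_) h2)
          gcongr
      _ ≤ (1 + |s| * L) * (L * B * s ^ 2 * k * (1 + |s| * L) ^ k)
            + L * B * s ^ 2 * (1 + |s| * L) ^ (k + 1) := by gcongr
      _ = _ := by push_cast; ring

/-- The explicit Euler scheme converges to the flow. -/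
theorem IsGlobalFlow.tendsto_iterate_eulerStep (hΦ : IsGlobalFlow V Φ) (hL : LipschitzWith L V)
    (hB : ∀ x, ‖V x‖ ≤ B) (t : ℝ) (x : E) :
    Tendsto (fun n : ℕ => (eulerStep V (t / n))^[n] x) atTop (𝓝 (Φ t x)) := by
  have hB0 : 0 ≤ B := (norm_nonneg _).trans (hB x)
  rw [tendsto_iff_norm_sub_tendsto_zero]
  refine squeeze_zero' (g := fun n : ℕ => L * B * t ^ 2 * Real.exp (|t| * L) / n)
    (Eventually.of_forall fun _ => norm_nonneg _) ?_
    (tendsto_const_div_atTop_nhds_zero_nat _)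
  filter_upwards [eventually_gt_atTop 0] with n hn
  have hn' : (0 : ℝ) < n := by exact_mod_cast hn
  have h1 := hΦ.norm_iterate_eulerStep_sub_le hL hB (t / n) x n
  rw [mul_div_cancel₀ t hn'.ne'] at h1
  have h2 : (1 + |t / n| * L) ^ n ≤ Real.exp (|t| * L) := by
    calc (1 + |t / n| * L) ^ n ≤ Real.exp (|t / n| * L) ^ n := by
          gcongr
          rw [add_comm]; exact Real.add_one_le_exp _
      _ = _ := by
          rw [← Real.exp_nat_mul, abs_div, abs_of_pos hn']
          congr 1; field_simp
  calc _ ≤ L * B * (t / n) ^ 2 * n * Real.exp (|t| * L) := h1.trans (by gcongr)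
    _ = _ := by field_simp

theorem IsGlobalFlow.measurable [MeasurableSpace E] [BorelSpace E] (hΦ : IsGlobalFlow V Φ)
    (hL : LipschitzWith L V) (hB : ∀ x, ‖V x‖ ≤ B) (t : ℝ) : Measurable (Φ t) :=
  measurable_of_tendsto_metrizable
    (fun n => ((continuous_eulerStep hL (t / n)).iterate n).measurable)
    (tendsto_pi_nhds.2 fun x => hΦ.tendsto_iterate_eulerStep hL hB t x)

theorem IsGlobalFlow.measurableEmbedding [MeasurableSpace E] [BorelSpace E]
    (hΦ : IsGlobalFlow V Φ) (hL : LipschitzWith L V)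
    (hB : ∀ x, ‖V x‖ ≤ B) (t : ℝ) : MeasurableEmbedding (Φ t) :=
  MeasurableEquiv.measurableEmbedding
    { toFun := Φ t
      invFun := Φ (-t)
      left_inv := hΦ.neg_apply_apply hL t
      right_inv := hΦ.apply_neg_apply hL t
      measurable_toFun := hΦ.measurable hL hB t
      measurable_invFun := hΦ.measurable hL hB (-t) }

end Flow

section Liouville

variable {E : Type*} [NormedAddCommGroup E] [NormedSpace ℝ E] [FiniteDimensional ℝ E]
  [MeasurableSpace E] [BorelSpace E] {μ : Measure E} [μ.IsAddHaarMeasure]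
  {V : E → E} {Φ : ℝ → E → E} {L : NNReal} {B C : ℝ}

theorem measure_preimage_eulerStep_le (hV : Differentiable ℝ V) (hL : LipschitzWith L V) {s m : ℝ}
    (hs : |s| * L < 1)
    (hm : ∀ x, m ≤ |(ContinuousLinearMap.id ℝ E + s • fderiv ℝ V x).det|)
    {A : Set E} (hA : MeasurableSet A) :
    ENNReal.ofReal m * μ (eulerStep V s ⁻¹' A) ≤ μ A := by
  have hd : ∀ x, HasFDerivAt (eulerStep V s) (ContinuousLinearMap.id ℝ E + s • fderiv ℝ V x) x :=
    fun x => (hasFDerivAt_id x).add ((hV x).hasFDerivAt.const_smul s)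
  have h1 := lintegral_abs_det_fderiv_eq_addHaar_image μ
    ((continuous_eulerStep hL s).measurable hA) (fun x _ => (hd x).hasFDerivWithinAt)
    (eulerStep_injective hL hs).injOn
  calc ENNReal.ofReal m * μ (eulerStep V s ⁻¹' A)
      = ∫⁻ _ in eulerStep V s ⁻¹' A, ENNReal.ofReal m ∂μ := by simp
    _ ≤ _ := lintegral_mono fun x => ENNReal.ofReal_le_ofReal (hm x)
    _ = μ (eulerStep V s '' (eulerStep V s ⁻¹' A)) := h1
    _ ≤ μ A := measure_mono (Set.image_preimage_subset _ _)

theorem measure_preimage_iterate_eulerStep_le (hV : Differentiable ℝ V) (hL : LipschitzWith L V)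
    {s m : ℝ} (hs : |s| * L < 1)
    (hm : ∀ x, m ≤ |(ContinuousLinearMap.id ℝ E + s • fderiv ℝ V x).det|)
    {A : Set E} (hA : MeasurableSet A) (n : ℕ) :
    ENNReal.ofReal m ^ n * μ ((eulerStep V s)^[n] ⁻¹' A) ≤ μ A := by
  induction n with
  | zero => simp
  | succ n ih =>
    rw [Function.iterate_succ, Set.preimage_comp, pow_succ, mul_assoc]
    refine le_trans ?_ ih
    gcongr
    exact measure_preimage_eulerStep_le hV hL hs hm
      (((continuous_eulerStep hL s).iterate n).measurable hA)

theorem IsGlobalFlow.measure_preimage_le_of_isOpen (hΦ : IsGlobalFlow V Φ)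
    (hV : Differentiable ℝ V) (hL : LipschitzWith L V) (hB : ∀ x, ‖V x‖ ≤ B)
    (hdet : ∀ s x, 1 - C * s ^ 2 ≤ |(ContinuousLinearMap.id ℝ E + s • fderiv ℝ V x).det|)
    (t : ℝ) {U : Set E} (hU : IsOpen U) : μ (Φ t ⁻¹' U) ≤ μ U := by
  set A : ℕ → Set E := fun n => (eulerStep V (t / n))^[n] ⁻¹' U
  have hsub : Φ t ⁻¹' U ⊆ ⋃ N, ⋂ n ≥ N, A n := by
    intro x hx
    have := (hΦ.tendsto_iterate_eulerStep hL hB t x).eventually (hU.mem_nhds hx)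
    obtain ⟨N, hN⟩ := eventually_atTop.1 this
    exact Set.mem_iUnion.2 ⟨N, Set.mem_iInter₂.2 hN⟩
  have hmono : Monotone fun N => ⋂ n ≥ N, A n := fun N M h =>
    Set.biInter_mono (fun n (hn : M ≤ n) => h.trans hn) fun _ _ => subset_rfl
  refine (measure_mono hsub).trans ?_
  rw [hmono.measure_iUnion]
  refine iSup_le fun N => ?_
  have hsmall : Tendsto (fun n : ℕ => |t| * L / n) atTop (𝓝 0) :=
    tendsto_const_div_atTop_nhds_zero_nat _
  have hlim : Tendsto (fun n : ℕ => ENNReal.ofReal (1 - C * t ^ 2 / n) * μ (⋂ n ≥ N, A n)) atTop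
      (𝓝 (1 * μ (⋂ n ≥ N, A n))) := by
    refine ENNReal.Tendsto.mul_const ?_ (Or.inl one_ne_zero)
    rw [← ENNReal.ofReal_one]
    refine ENNReal.tendsto_ofReal ?_
    simpa using (tendsto_const_div_atTop_nhds_zero_nat (C * t ^ 2)).const_sub 1
  rw [one_mul] at hlim
  have hsq : Tendsto (fun n : ℕ => C * t ^ 2 / n / n) atTop (𝓝 0) := by
    have h1 := (tendsto_const_div_atTop_nhds_zero_nat (C * t ^ 2)).mul
      (tendsto_const_div_atTop_nhds_zero_nat (1 : ℝ))
    simpa [div_eq_mul_inv] using h1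
  refine le_of_tendsto hlim ?_
  filter_upwards [eventually_ge_atTop N, eventually_gt_atTop 0,
    hsmall.eventually (gt_mem_nhds one_pos), hsq.eventually (gt_mem_nhds one_pos)]
    with n hn hn0 hn1 hn2
  have hn' : (0 : ℝ) < n := by exact_mod_cast hn0
  have hs : |t / n| * L < 1 := by
    rwa [abs_div, abs_of_pos hn', div_mul_eq_mul_div]
  have key := measure_preimage_iterate_eulerStep_le (μ := μ) hV hL hs (hdet (t / n)) hU.measurableSet n
  refine le_trans ?_ key
  have hpow : 1 - C * t ^ 2 / n ≤ (1 - C * (t / n) ^ 2) ^ n := by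
    have e : C * (t / n) ^ 2 = C * t ^ 2 / n / n := by field_simp
    have := one_add_mul_le_pow (a := -(C * (t / n) ^ 2)) (by rw [e]; linarith) n
    rw [← sub_eq_add_neg] at this
    refine le_trans (le_of_eq ?_) this
    field_simp
    ring
  have hnn : 0 ≤ 1 - C * (t / n) ^ 2 := by
    have e : C * (t / n) ^ 2 = C * t ^ 2 / n / n := by field_simp
    rw [e]; linarith
  rw [← ENNReal.ofReal_pow hnn]
  gcongr
  exact Set.biInter_subset_of_mem hn

/-- **Liouville's theorem**: the flow of a field whose Euler steps distort volume to second order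
only is measure preserving. -/
theorem IsGlobalFlow.measurePreserving (hΦ : IsGlobalFlow V Φ)
    (hV : Differentiable ℝ V) (hL : LipschitzWith L V) (hB : ∀ x, ‖V x‖ ≤ B)
    (hdet : ∀ s x, 1 - C * s ^ 2 ≤ |(ContinuousLinearMap.id ℝ E + s • fderiv ℝ V x).det|)
    (t : ℝ) : MeasurePreserving (Φ t) μ μ := by
  have hle : ∀ t (A : Set E), μ (Φ t ⁻¹' A) ≤ μ A := by
    intro t A
    refine le_of_forall_gt fun r hr => ?_
    obtain ⟨U, hAU, hU, hUr⟩ := A.exists_isOpen_lt_of_lt r hr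
    exact ((measure_mono (Set.preimage_mono hAU)).trans
      (hΦ.measure_preimage_le_of_isOpen hV hL hB hdet t hU)).trans_lt hUr
  refine ⟨hΦ.measurable hL hB t, Measure.ext fun A hA => ?_⟩
  rw [Measure.map_apply (hΦ.measurable hL hB t) hA]
  refine (hle t A).antisymm ?_
  have := hle (-t) (Φ t ⁻¹' A)
  rwa [← Set.preimage_comp, show Φ t ∘ Φ (-t) = id from funext (hΦ.apply_neg_apply hL t),
    Set.preimage_id] at this

end Liouville

section Variation

variable {E : Type*} [NormedAddCommGroup E] [NormedSpace ℝ E] [FiniteDimensional ℝ E]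
  [MeasurableSpace E] [BorelSpace E] {μ : Measure E} [IsFiniteMeasureOnCompacts μ]
  {V : E → E} {Φ : ℝ → E → E} {L : NNReal} {B : ℝ}

/-- First variation of `t ↦ ∫ g d(Φ_t)_*(ω μ)` for a function `g` that is `C¹` near the support
of `ω`. -/
theorem IsGlobalFlow.hasDerivAt_integral_comp_mul (hΦ : IsGlobalFlow V Φ)
    (hL : LipschitzWith L V) (hB : ∀ x, ‖V x‖ ≤ B) {g ω : E → ℝ} {U S : Set E} {M : ℝ}
    (hg : Measurable g) (hU : IsOpen U) (hgU : ContDiffOn ℝ 1 g U) (hS : IsCompact S)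
    (hSU : S ⊆ U) (hω : Measurable ω) (hωM : ∀ x, |ω x| ≤ M) (hωS : Function.support ω ⊆ S) :
    HasDerivAt (fun t => ∫ z, g (Φ t z) * ω z ∂μ) (∫ z, fderiv ℝ g z (V z) * ω z ∂μ) 0 := by
  have := FiniteDimensional.proper ℝ E
  obtain ⟨δ, hδ, hδU⟩ := hS.exists_cthickening_subset_open hU hSU
  have hT : IsCompact (cthickening δ S) := hS.cthickening
  have hdg : ∀ x ∈ U, HasFDerivAt g (fderiv ℝ g x) x := fun x hx =>
    ((hgU.differentiableOn one_ne_zero).differentiableAt (hU.mem_nhds hx)).hasFDerivAt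
  obtain ⟨C, hC⟩ := hT.exists_bound_of_continuousOn
    ((hgU.continuousOn_fderiv_of_isOpen hU le_rfl).mono hδU)
  obtain ⟨C', hC'⟩ := hT.exists_bound_of_continuousOn (hgU.continuousOn.mono hδU)
  have hM : 0 ≤ M := (abs_nonneg _).trans (hωM 0)
  have hB0 : 0 ≤ B := (norm_nonneg _).trans (hB 0)
  have hmem : ∀ z ∈ S, ∀ t ∈ ball (0 : ℝ) (δ / (B + 1)), Φ t z ∈ cthickening δ S :=
    fun z hz t ht => hΦ.mem_cthickening hB hz ht
  have hconst : ∀ c : ℝ, Integrable (S.indicator fun _ => c) μ := fun c =>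
    (integrable_indicator_iff hS.measurableSet).2 (integrableOn_const hS.measure_lt_top.ne)
  have hball : ball (0 : ℝ) (δ / (B + 1)) ∈ 𝓝 0 := ball_mem_nhds _ (by positivity)
  have hmeas : ∀ t, AEStronglyMeasurable (fun z => g (Φ t z) * ω z) μ := fun t =>
    ((hg.comp (hΦ.measurable hL hB t)).mul hω).aestronglyMeasurable
  have hω0 : ∀ z ∉ S, ω z = 0 := fun z hz => by
    by_contra h
    exact hz (hωS h)
  have h0 : HasDerivAt (fun t => ∫ z, g (Φ t z) * ω z ∂μ)
      (∫ z, fderiv ℝ g (Φ 0 z) (V (Φ 0 z)) * ω z ∂μ) 0 := by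
    refine (hasDerivAt_integral_of_dominated_loc_of_deriv_le (s := ball (0 : ℝ) (δ / (B + 1)))
      (F' := fun t z => fderiv ℝ g (Φ t z) (V (Φ t z)) * ω z)
      (bound := S.indicator fun _ => C * B * M) hball (Eventually.of_forall hmeas) ?_ ?_ ?_
      (hconst _) ?_).2
    · refine (hconst (C' * M)).mono' (hmeas 0) (Eventually.of_forall fun z => ?_)
      by_cases hz : z ∈ S
      · have h1 := hC' _ (hmem z hz 0 (mem_of_mem_nhds hball))
        rw [Set.indicator_of_mem hz, norm_mul]
        exact mul_le_mul h1 (hωM z) (norm_nonneg _) ((norm_nonneg _).trans h1)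
      · simp [hω0 z hz, hz]
    · simp only [hΦ.map_zero]
      refine Measurable.aestronglyMeasurable (Measurable.mul ?_ hω)
      exact ContinuousLinearMap.measurable_apply₂.comp
        ((measurable_fderiv ℝ g).prodMk hL.continuous.measurable)
    · refine Eventually.of_forall fun z t ht => ?_
      by_cases hz : z ∈ S
      · have h1 := hC _ (hmem z hz t ht)
        have hC0 := (norm_nonneg _).trans h1
        rw [Set.indicator_of_mem hz, norm_mul]
        refine mul_le_mul ?_ (hωM z) (norm_nonneg _) (by positivity)
        exact ((fderiv ℝ g (Φ t z)).le_opNorm _).trans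
          (mul_le_mul h1 (hB _) (norm_nonneg _) hC0)
      · simp [hω0 z hz, hz]
    · refine Eventually.of_forall fun z t ht => ?_
      by_cases hz : z ∈ S
      · exact ((hdg _ (hδU (hmem z hz t ht))).comp_hasDerivAt t (hΦ.hasDerivAt z t)).mul_const _
      · simpa [hω0 z hz] using hasDerivAt_const t (0 : ℝ)
  simpa only [hΦ.map_zero] using h0

end Variation

section HamiltonianField

variable {φ : E2 → ℝ}

theorem hamVF_apply_zero (x : E2) : hamVF φ x 0 = pd φ 1 x := rfl

theorem hamVF_apply_one (x : E2) : hamVF φ x 1 = -pd φ 0 x := rfl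

theorem contDiff_pd (hφ : ContDiff ℝ 2 φ) (i : Fin 2) : ContDiff ℝ 1 (pd φ i) :=
  (hφ.fderiv_right (m := 1) one_add_one_eq_two.le).clm_apply contDiff_const

theorem contDiff_hamVF (hφ : ContDiff ℝ 2 φ) : ContDiff ℝ 1 (hamVF φ) := by
  rw [contDiff_euclidean]
  intro i
  fin_cases i
  · exact contDiff_pd hφ 1
  · exact (contDiff_pd hφ 0).neg

theorem hasCompactSupport_hamVF (hφ : HasCompactSupport φ) : HasCompactSupport (hamVF φ) := by
  refine (hφ.fderiv ℝ).mono fun x hx => ?_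
  contrapose! hx
  have h0 : fderiv ℝ φ x = 0 := by simpa using hx
  have : hamVF φ x = 0 := by
    ext i
    fin_cases i
    · simp [hamVF, pd, h0]
    · simp [hamVF, pd, h0]
  simpa using this

theorem fderiv_pd_comm (hφ : ContDiff ℝ 2 φ) (x : E2) (i j : Fin 2) :
    fderiv ℝ (pd φ i) x (EuclideanSpace.single j 1) =
      fderiv ℝ (pd φ j) x (EuclideanSpace.single i 1) := by
  have hd : DifferentiableAt ℝ (fderiv ℝ φ) x :=
    (hφ.fderiv_right (m := 1) one_add_one_eq_two.le).differentiable one_ne_zero x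
  have h (k : Fin 2) (v : E2) : fderiv ℝ (pd φ k) x v =
      fderiv ℝ (fderiv ℝ φ) x v (EuclideanSpace.single k 1) := by
    have := hd.hasFDerivAt.clm_apply (hasFDerivAt_const (EuclideanSpace.single k (1 : ℝ)) x)
    rw [HasFDerivAt.fderiv (f := pd φ k) this]
    simp
  rw [h, h]
  exact hφ.contDiffAt.isSymmSndFDerivAt (by simp) _ _

theorem det_id_add_smul_fderiv_hamVF (hφ : ContDiff ℝ 2 φ) (s : ℝ) (x : E2) :
    (ContinuousLinearMap.id ℝ E2 + s • fderiv ℝ (hamVF φ) x).det =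
      1 + s ^ 2 * (fderiv ℝ (hamVF φ) x (EuclideanSpace.single 0 1) 0 *
          fderiv ℝ (hamVF φ) x (EuclideanSpace.single 1 1) 1 -
        fderiv ℝ (hamVF φ) x (EuclideanSpace.single 1 1) 0 *
          fderiv ℝ (hamVF φ) x (EuclideanSpace.single 0 1) 1) := by
  have hV : HasFDerivAt (hamVF φ) (fderiv ℝ (hamVF φ) x) x :=
    ((contDiff_hamVF hφ).differentiable one_ne_zero x).hasFDerivAt
  have hc (i : Fin 2) (v : E2) : fderiv ℝ (hamVF φ) x v i =
      fderiv ℝ (fun y => hamVF φ y i) x v := by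
    have := (EuclideanSpace.proj (𝕜 := ℝ) i).hasFDerivAt.comp x hV
    exact (congrArg (· v) this.fderiv).symm
  have htr : fderiv ℝ (hamVF φ) x (EuclideanSpace.single 0 1) 0 +
      fderiv ℝ (hamVF φ) x (EuclideanSpace.single 1 1) 1 = 0 := by
    rw [hc, hc]
    have h1 : (fun y => hamVF φ y 1) = -pd φ 0 := rfl
    have h0 : (fun y => hamVF φ y 0) = pd φ 1 := rfl
    rw [h0, h1, fderiv_neg, neg_apply, fderiv_pd_comm hφ x 0 1]
    ring
  rw [ContinuousLinearMap.det, ← LinearMap.det_toMatrix (EuclideanSpace.basisFun (Fin 2) ℝ).toBasis,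
    Matrix.det_fin_two]
  simp [LinearMap.toMatrix_apply]
  linear_combination s * htr

theorem one_sub_le_abs_det_id_add_smul_fderiv_hamVF (hφ : ContDiff ℝ 2 φ) {L : NNReal}
    (hL : LipschitzWith L (hamVF φ)) (s : ℝ) (x : E2) :
    1 - 2 * (L : ℝ) ^ 2 * s ^ 2 ≤
      |(ContinuousLinearMap.id ℝ E2 + s • fderiv ℝ (hamVF φ) x).det| := by
  rw [det_id_add_smul_fderiv_hamVF hφ]
  have hentry (i j : Fin 2) : |fderiv ℝ (hamVF φ) x (EuclideanSpace.single i 1) j| ≤ L := by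
    have h1 := PiLp.norm_apply_le (fderiv ℝ (hamVF φ) x (EuclideanSpace.single i 1)) j
    have h2 := (fderiv ℝ (hamVF φ) x).le_opNorm (EuclideanSpace.single i 1)
    have h3 := norm_fderiv_le_of_lipschitz ℝ hL (x₀ := x)
    rw [PiLp.norm_single, norm_one, mul_one] at h2
    exact h1.trans (h2.trans h3)
  have hprod (i j k l : Fin 2) : |fderiv ℝ (hamVF φ) x (EuclideanSpace.single i 1) j *
      fderiv ℝ (hamVF φ) x (EuclideanSpace.single k 1) l| ≤ (L : ℝ) ^ 2 := by
    rw [abs_mul, sq]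
    exact mul_le_mul (hentry i j) (hentry k l) (abs_nonneg _) L.coe_nonneg
  have h1 := (abs_le.1 (hprod 0 0 1 1)).1
  have h2 := (abs_le.1 (hprod 1 0 0 1)).2
  refine le_trans ?_ (le_abs_self _)
  nlinarith [sq_nonneg s]

theorem fderiv_apply_hamVF (g : E2 → ℝ) (x : E2) : fderiv ℝ g x (hamVF φ x) = jac g φ x := by
  have e : hamVF φ x = pd φ 1 x • EuclideanSpace.single 0 (1 : ℝ) -
      pd φ 0 x • EuclideanSpace.single 1 (1 : ℝ) := by
    ext i
    fin_cases i
    · simp [hamVF_apply_zero]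
    · simp [hamVF_apply_one]
  rw [e, map_sub, map_smul, map_smul, jac, smul_eq_mul, smul_eq_mul, mul_comm (pd φ 1 x),
    mul_comm (pd φ 0 x)]
  rfl

end HamiltonianField

theorem contDiffOn_green {D : Set E2} {h G : E2 → E2 → ℝ}
    (hsymm : ∀ x ∈ D, ∀ y ∈ D, h x y = h y x)
    (hreg : ∀ y ∈ D, ContDiffOn ℝ 1 (fun x => h x y) D)
    (hG : ∀ x y, G x y = (1 / (2 * π)) * Real.log (1 / dist x y) - h x y)
    {x0 : E2} (hx0 : x0 ∈ D) : ContDiffOn ℝ 1 (G x0) (D \ {x0}) := by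
  have hlog : ContDiffOn ℝ 1 (fun y => (1 / (2 * π)) * Real.log (1 / dist x0 y)) (D \ {x0}) := by
    intro y hy
    have hne : x0 ≠ y := fun e => hy.2 e.symm
    have hdist : ContDiffAt ℝ 1 (fun y => dist x0 y) y :=
      contDiffAt_const.dist ℝ contDiffAt_id hne
    exact (contDiffAt_const.mul ((contDiffAt_const.div hdist (dist_ne_zero.2 hne)).log
      (one_div_ne_zero (dist_ne_zero.2 hne)))).contDiffWithinAt
  refine (hlog.sub ((hreg x0 hx0).mono Set.sdiff_subset)).congr fun y hy => ?_
  rw [hG, hsymm x0 hx0 y hy.1]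

theorem first_variation_of_stream_function
    (D : Set E2) (hDopen : IsOpen D) (hDbdd : Bornology.IsBounded D)
    (hDsc : SimplyConnectedSpace D)
    (h : E2 → E2 → ℝ)
    (hcont : ContinuousOn (fun q : E2 × E2 => h q.1 q.2) (D ×ˢ D))
    (hsymm : ∀ x ∈ D, ∀ y ∈ D, h x y = h y x)
    (hharm : ∀ y ∈ D, ContDiffOn ℝ 2 (fun x => h x y) D ∧
      ∀ x ∈ D, ∑ i : Fin 2,
        iteratedFDerivWithin ℝ 2 (fun x' => h x' y) D x
          ![EuclideanSpace.single i 1, EuclideanSpace.single i 1] = 0)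
    (G : E2 → E2 → ℝ)
    (hG : ∀ x y, G x y = (1 / (2 * π)) * Real.log (1 / dist x y) - h x y)
    (hGbdry : ∀ y ∈ D, ∀ z ∈ frontier D,
      Tendsto (fun x => G x y) (𝓝[D] z) (𝓝 0))
    -- ω ∈ L^∞(D) with essential support compactly contained in D
    (ω : E2 → ℝ) (hωmeas : Measurable ω)
    (M : ℝ) (hωbdd : ∀ x, |ω x| ≤ M)
    (K : Set E2) (hK : IsCompact K) (hKD : K ⊆ D)
    (hωsupp : Function.support ω ⊆ K)
    -- φ ∈ C_c^∞(D)
    (φ : E2 → ℝ) (hφ : ContDiff ℝ (⊤ : ℕ∞) φ) (hφsupp : HasCompactSupport φ)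
    (hφD : tsupport φ ⊆ D)
    -- Φ is the flow of the vector field J∇φ
    (Φ : ℝ → E2 → E2)
    (hΦ0 : ∀ x : E2, Φ 0 x = x)
    (hΦode : ∀ x : E2, ∀ t : ℝ, HasDerivAt (fun s => Φ s x) (hamVF φ (Φ t x)) t)
    -- x0 is a point of D at positive distance from the support of ω
    (x0 : E2) (hx0 : x0 ∈ D)
    (r : ℝ) (hr : 0 < r) (hx0supp : ∀ y ∈ Function.support ω, r ≤ dist x0 y) :
    HasDerivAt
      (fun t => ∫ y in D, G x0 y * ω (Φ (-t) y))
      (∫ y in D, ω y * jac (fun y' => G x0 y') φ y) 0 := by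
  set S := closure (Function.support ω)
  set U := D \ {x0}
  have hU : IsOpen U := hDopen.sdiff isClosed_singleton
  have hSK : S ⊆ K := closure_minimal hωsupp hK.isClosed
  have hS : IsCompact S := hK.of_isClosed_subset isClosed_closure hSK
  have hSU : S ⊆ U := fun y hy => by
    have h1 : S ⊆ {y | r ≤ dist x0 y} :=
      closure_minimal hx0supp (isClosed_le continuous_const (continuous_const.dist continuous_id))
    refine ⟨hKD (hSK hy), ?_⟩
    rintro rfl
    have h2 : r ≤ dist y y := h1 hy
    rw [dist_self] at h2
    linarith
  have hGU : ContDiffOn ℝ 1 (G x0) U := contDiffOn_green hsymm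
    (fun y hy => (hharm y hy).1.of_le one_le_two) hG hx0
  set g := U.indicator (G x0) with hgdef
  have hgG : Set.EqOn g (G x0) U := fun y hy => Set.indicator_of_mem hy _
  have hg : Measurable g := by
    classical
    rw [hgdef, ← Set.piecewise_eq_indicator]
    exact hGU.continuousOn.measurable_piecewise continuousOn_const hU.measurableSet
  have hφ2 : ContDiff ℝ 2 φ := contDiff_infty.1 hφ 2
  have hV := contDiff_hamVF hφ2
  have hVs := hasCompactSupport_hamVF hφsupp
  obtain ⟨L, hL⟩ := hV.lipschitzWith_of_hasCompactSupport hVs one_ne_zero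
  obtain ⟨B, hB⟩ := hVs.exists_bound_of_continuous hV.continuous
  have hflow : IsGlobalFlow (hamVF φ) Φ := ⟨hΦ0, hΦode⟩
  have hpres (t : ℝ) : MeasurePreserving (Φ t) volume volume :=
    hflow.measurePreserving (hV.differentiable one_ne_zero) hL hB
      (one_sub_le_abs_det_id_add_smul_fderiv_hamVF hφ2 hL) t
  have hderiv := hflow.hasDerivAt_integral_comp_mul (μ := volume) hL hB hg hU (hGU.congr hgG) hS
    hSU hωmeas hωbdd subset_closure
  have hω0 : ∀ y ∉ U, ω y = 0 := fun y hy => by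
    by_contra hne
    exact hy (hSU (subset_closure hne))
  have hval : ∫ y, fderiv ℝ g y (hamVF φ y) * ω y = ∫ y in D, ω y * jac (fun y' => G x0 y') φ y := by
    rw [← integral_indicator hDopen.measurableSet]
    congr 1 with y
    by_cases hy : y ∈ U
    · rw [Set.indicator_of_mem hy.1, (hgG.eventuallyEq_of_mem (hU.mem_nhds hy)).fderiv_eq,
        fderiv_apply_hamVF, mul_comm]
    · rw [hω0 y hy, mul_zero, eq_comm, Set.indicator_apply_eq_zero]
      intro _
      rw [hω0 y hy, zero_mul]
  rw [hval] at hderiv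
  refine hderiv.congr_of_eventuallyEq ?_
  obtain ⟨δ, hδ, hδU⟩ := hS.exists_cthickening_subset_open hU hSU
  have hB0 : 0 ≤ B := (norm_nonneg _).trans (hB 0)
  filter_upwards [ball_mem_nhds (0 : ℝ) (show 0 < δ / (B + 1) by positivity)] with t ht
  have hmem : ∀ z, ω z ≠ 0 → Φ t z ∈ U := fun z hz =>
    hδU (hflow.mem_cthickening hB (subset_closure hz) ht)
  calc ∫ y in D, G x0 y * ω (Φ (-t) y) = ∫ y, g y * ω (Φ (-t) y) := by
        rw [← integral_indicator hDopen.measurableSet]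
        congr 1 with y
        by_cases hy : ω (Φ (-t) y) = 0
        · simp [hy]
        · have hyU := hmem _ hy
          rw [hflow.apply_neg_apply hL] at hyU
          rw [Set.indicator_of_mem hyU.1, hgG hyU]
    _ = ∫ z, g (Φ t z) * ω (Φ (-t) (Φ t z)) :=
        ((hpres t).integral_comp (hflow.measurableEmbedding hL hB t) _).symm
    _ = ∫ z, g (Φ t z) * ω z := by simp only [hflow.neg_apply_apply hL]
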